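/- Let a¹, …, aᴺ (N ≥ 1) be coefficient families, each τ-invariant and at most 1-singular on W, where W is admissible, and let A = a¹ ∘ ⋯ ∘ aᴺ be their product. Then for every F : ℂ × (Fin d → ℂ) → ℂ analytic on W with F ∘ τ = F on W, the function A · F, defined on {(z₁, z′) ∈ W : z₁ ≠ 0}, extends analytically at v; moreover there exist finitely supported coefficients c, c′ : ℤ × (Fin d → ℤ) → ℂ, independent of F, such that for every such F the value at v of the analytic extension of A · F equals Σ_{(m,μ)} c_{(m,μ)} · (1/2)(F(−m, w₀ − μ) + F(m, w₀ − μ)) + Σ_{(m,μ)} c′_{(m,μ)} · ∂₁F(−m, w₀ − μ), where ∂₁F(−m, w₀ − μ) denotes the derivative at −m of t ↦ F(t, w₀ − μ). -/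

import Mathlib

open Topology Filter

noncomputable section

/-- The involution `τ (z₁, z′) = (-z₁, z′)` on `ℂ × (Fin d → ℂ)`. -/
def tauMap (d : ℕ) : ℂ × (Fin d → ℂ) → ℂ × (Fin d → ℂ) := fun p => (-p.1, p.2)

/-- Translation of a point: `(z₁, z′) ↦ (z₁ - m, z′ - μ)`. -/
def shiftPt (d : ℕ) (σ : ℤ × (Fin d → ℤ)) (p : ℂ × (Fin d → ℂ)) :
    ℂ × (Fin d → ℂ) :=
  (p.1 - (σ.1 : ℂ), fun i => p.2 i - (σ.2 i : ℂ))

/-- A coefficient family. -/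
abbrev Fam (d : ℕ) := (ℤ × (Fin d → ℤ)) → ℂ × (Fin d → ℂ) → ℂ

/-- The family is finitely supported. -/
def FinSuppFam (d : ℕ) (a : Fam d) : Prop := (Function.support a).Finite

/-- `τ`-invariance of a family: `a_{(-m,μ)} (z₁, z′) = a_{(m,μ)} (-z₁, z′)`. -/
def TauInvFam (d : ℕ) (a : Fam d) : Prop :=
  ∀ (m : ℤ) (μ : Fin d → ℤ) (p : ℂ × (Fin d → ℂ)),
    a (-m, μ) p = a (m, μ) (tauMap d p)

/-- The family `a` is at most `1`-singular on `W`. -/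
def OneSingOn (d : ℕ) (W : Set (ℂ × (Fin d → ℂ))) (a : Fam d) : Prop :=
  ∀ σ : ℤ × (Fin d → ℤ), ∃ g : ℂ × (Fin d → ℂ) → ℂ, AnalyticOnNhd ℂ g W ∧
    ∀ p ∈ W, p.1 ≠ 0 → a σ p = g p / p.1

/-- `W` is admissible: open, contains `v = (0, w₀)`, and invariant under `τ`
and under all integer translations. -/
def Admissible (d : ℕ) (w₀ : Fin d → ℂ) (W : Set (ℂ × (Fin d → ℂ))) : Prop :=
  IsOpen W ∧ ((0 : ℂ), w₀) ∈ W ∧ (∀ p ∈ W, tauMap d p ∈ W) ∧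
    ∀ (σ : ℤ × (Fin d → ℤ)), ∀ p ∈ W, shiftPt d σ p ∈ W

/-- Product of two coefficient families (the skew group ring multiplication). -/
def composeFam (d : ℕ) (a b : Fam d) : Fam d :=
  fun σ p => ∑ᶠ σ₁ : ℤ × (Fin d → ℤ), a σ₁ p * b (σ - σ₁) (shiftPt d σ₁ p)

/-- The identity coefficient family. -/
def oneFam (d : ℕ) : Fam d := fun σ _ => if σ = 0 then 1 else 0

/-- Product `a¹ ∘ a² ∘ ⋯ ∘ aᴺ` of a list of coefficient families. -/
def prodFam (d : ℕ) : List (Fam d) → Fam d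
  | [] => oneFam d
  | a :: l => composeFam d a (prodFam d l)

/-- Action of a coefficient family on a function. -/
def actFam (d : ℕ) (a : Fam d) (F : ℂ × (Fin d → ℂ) → ℂ) :
    ℂ × (Fin d → ℂ) → ℂ :=
  fun p => ∑ᶠ σ : ℤ × (Fin d → ℤ), a σ p * F (shiftPt d σ p)

/-- Averaging an analytic function over a continuous family of contractions fixing the centre
gives an analytic function. -/
theorem AnalyticAt.intervalIntegral_comp_contraction {E : Type*} [NormedAddCommGroup E]
    [NormedSpace ℂ E] {φ : E → ℂ} {x : E} (hφ : AnalyticAt ℂ φ x) (L : ℝ → E →L[ℂ] E)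
    (hL : Continuous L) (hL1 : ∀ t ∈ Set.Icc (0 : ℝ) 1, ‖L t‖ ≤ 1) :
    AnalyticAt ℂ (fun z => ∫ t in (0 : ℝ)..1, φ (x + L t (z - x))) x := by
  obtain ⟨p, r, hp⟩ := hφ
  have hcont (n : ℕ) :
      Continuous fun t => (p n).compContinuousLinearMap fun _ : Fin n => L t := by
    have := ((p n).compContinuousLinearMapLRight (E := fun _ => E)).cont
    exact this.comp (continuous_pi fun _ => hL)
  have hnorm (n : ℕ) (t : ℝ) (ht : t ∈ Set.Icc (0 : ℝ) 1) :
      ‖(p n).compContinuousLinearMap fun _ : Fin n => L t‖ ≤ ‖p n‖ := by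
    refine (ContinuousMultilinearMap.norm_compContinuousLinearMap_le _ _).trans ?_
    exact mul_le_of_le_one_right (norm_nonneg _)
      (Finset.prod_le_one (fun _ _ => norm_nonneg _) fun _ _ => hL1 t ht)
  have hIoc : Set.uIoc (0 : ℝ) 1 ⊆ Set.Icc 0 1 := by
    rw [Set.uIoc_of_le zero_le_one]; exact Set.Ioc_subset_Icc_self
  let q : FormalMultilinearSeries ℂ E ℂ := fun n =>
    ∫ t in (0 : ℝ)..1, (p n).compContinuousLinearMap fun _ : Fin n => L t
  have hq (n : ℕ) : ‖q n‖ ≤ ‖p n‖ := by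
    have := intervalIntegral.norm_integral_le_of_norm_le_const (a := (0 : ℝ)) (b := 1)
      (f := fun t => (p n).compContinuousLinearMap fun _ : Fin n => L t) (C := ‖p n‖)
      fun t ht => hnorm n t (hIoc ht)
    simpa using this
  refine ⟨q, r, hp.r_le.trans (FormalMultilinearSeries.radius_le_of_le hq), hp.r_pos, ?_⟩
  intro y hy
  have happ (n : ℕ) : q n (fun _ => y) = ∫ t in (0 : ℝ)..1, p n fun _ : Fin n => L t y :=
    ((ContinuousMultilinearMap.apply ℂ (fun _ : Fin n => E) ℂ
      (fun _ => y)).intervalIntegral_comp_comm ((hcont n).intervalIntegrable 0 1)).symm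
  simp only [happ, add_sub_cancel_left]
  have hy' : ‖y‖ₑ < r := by simpa using hy
  refine intervalIntegral.hasSum_integral_of_dominated_convergence
    (fun n _ => ‖p n‖ * ‖y‖ ^ n) ?_ ?_ ?_ ?_ ?_
  · intro n
    have h : Continuous fun t => p n fun _ : Fin n => L t y :=
      (p n).cont.comp (continuous_pi fun _ => hL.clm_apply continuous_const)
    exact h.aestronglyMeasurable
  · refine fun n => .of_forall fun t ht => ?_
    refine ((p n).le_opNorm _).trans ?_
    rw [Finset.prod_const, Finset.card_univ, Fintype.card_fin]
    gcongr
    exact ((L t).le_of_opNorm_le (hL1 t (hIoc ht)) y).trans_eq (one_mul _)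
  · refine .of_forall fun t _ => ?_
    exact p.summable_norm_mul_pow (r := ‖y‖₊) (lt_of_lt_of_le hy' hp.r_le)
  · exact intervalIntegrable_const
  · refine .of_forall fun t ht => hp.hasSum ?_
    rw [mem_eball_zero_iff]
    refine lt_of_le_of_lt ?_ hy'
    have := ((L t).le_of_opNorm_le (hL1 t (hIoc ht)) y).trans_eq (one_mul _)
    exact enorm_le_iff_norm_le.2 this

/-- The partial derivative of `H` in the first variable. -/
def derivFst {E : Type*} (H : ℂ × E → ℂ) (p : ℂ × E) : ℂ :=
  deriv (fun t => H (t, p.2)) p.1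

/-- `H / z₁`, extended to `z₁ = 0` by `∂₁ H`. -/
def divFst {E : Type*} (H : ℂ × E → ℂ) (p : ℂ × E) : ℂ :=
  if p.1 = 0 then derivFst H p else H p / p.1

section

variable {E : Type*} [NormedAddCommGroup E] [NormedSpace ℂ E]

theorem AnalyticAt.hasDerivAt_fst {H : ℂ × E → ℂ} {p : ℂ × E} (hH : AnalyticAt ℂ H p) :
    HasDerivAt (fun t => H (t, p.2)) (derivFst H p) p.1 := by
  have h : DifferentiableAt ℂ (fun t => H (t, p.2)) p.1 :=
    DifferentiableAt.comp (g := H) (f := fun t : ℂ => (t, p.2)) p.1 hH.differentiableAt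
      (by fun_prop)
  exact h.hasDerivAt

theorem AnalyticAt.derivFst_eq {H : ℂ × E → ℂ} {p : ℂ × E} (hH : AnalyticAt ℂ H p) :
    derivFst H p = fderiv ℂ H p (1, 0) := by
  have h := hH.differentiableAt.hasFDerivAt.comp_hasDerivAt (f := fun t : ℂ => (t, p.2)) p.1
    ((hasDerivAt_id p.1).prodMk (hasDerivAt_const p.1 p.2))
  exact h.deriv

theorem AnalyticAt.derivFst {H : ℂ × E → ℂ} {p : ℂ × E} (hH : AnalyticAt ℂ H p) :
    AnalyticAt ℂ (derivFst H) p := by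
  have h : AnalyticAt ℂ (fun q => fderiv ℂ H q (1, 0)) p :=
    ((ContinuousLinearMap.apply ℂ ℂ ((1, 0) : ℂ × E)).analyticAt _).comp hH.fderiv
  refine h.congr ?_
  filter_upwards [hH.eventually_analyticAt] with q hq using hq.derivFst_eq.symm

/-- An analytic function vanishing on `z₁ = 0` is analytically divisible by `z₁`. -/
theorem AnalyticAt.divFst {H : ℂ × E → ℂ} {p : ℂ × E} (hH : AnalyticAt ℂ H p)
    (h0 : ∀ᶠ q in 𝓝 p, q.1 = 0 → H q = 0) : AnalyticAt ℂ (divFst H) p := by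
  obtain ⟨z, w⟩ := p
  by_cases hz : z = 0
  swap
  · refine (hH.div analyticAt_fst hz).congr ?_
    filter_upwards [continuousAt_fst.eventually_ne hz] with q hq
    simp [_root_.divFst, hq]
  subst hz
  let L : ℝ → ℂ × E →L[ℂ] ℂ × E := fun t =>
    (t : ℂ) • (ContinuousLinearMap.inl ℂ ℂ E ∘L ContinuousLinearMap.fst ℂ ℂ E) +
      ContinuousLinearMap.inr ℂ ℂ E ∘L ContinuousLinearMap.snd ℂ ℂ E
  have hLapp (t : ℝ) (q : ℂ × E) : L t q = (t * q.1, q.2) := by simp [L]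
  have hL : Continuous L := by fun_prop
  have hL1 : ∀ t ∈ Set.Icc (0 : ℝ) 1, ‖L t‖ ≤ 1 := by
    refine fun t ht => ContinuousLinearMap.opNorm_le_bound _ zero_le_one fun q => ?_
    rw [hLapp, one_mul, Prod.norm_mk, Prod.norm_def]
    refine max_le_max ?_ le_rfl
    rw [norm_mul, Complex.norm_real, Real.norm_of_nonneg ht.1]
    exact mul_le_of_le_one_left (norm_nonneg _) ht.2
  refine (hH.derivFst.intervalIntegral_comp_contraction L hL hL1).congr ?_
  obtain ⟨ε, hε, hball⟩ := Metric.eventually_nhds_iff_ball.1 (hH.eventually_analyticAt.and h0)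
  filter_upwards [Metric.ball_mem_nhds _ hε] with q hq
  have hmem (t : ℝ) (ht : t ∈ Set.Icc (0 : ℝ) 1) :
      ((t : ℂ) * q.1, q.2) ∈ Metric.ball ((0 : ℂ), w) ε := by
    have := (L t).le_of_opNorm_le (hL1 t ht) (q - (0, w))
    rw [hLapp] at this
    rw [mem_ball_iff_norm] at hq ⊢
    simpa using this.trans_lt (by simpa using hq)
  have harg (t : ℝ) : ((0 : ℂ), w) + L t (q - (0, w)) = ((t : ℂ) * q.1, q.2) := by
    rw [hLapp]; ext <;> simp
  simp only [harg]
  by_cases hq0 : q.1 = 0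
  · simp [_root_.divFst, hq0, _root_.derivFst]
  rw [_root_.divFst, if_neg hq0, eq_div_iff hq0, ← intervalIntegral.integral_mul_const]
  have key := intervalIntegral.integral_eq_sub_of_hasDerivAt (a := (0 : ℝ)) (b := 1)
    (f := fun t : ℝ => H ((t : ℂ) * q.1, q.2))
    (f' := fun t : ℝ => _root_.derivFst H ((t : ℂ) * q.1, q.2) * q.1) ?_ ?_
  · rw [key]
    have h := hmem 0 (by simp)
    simp only [Complex.ofReal_zero, zero_mul] at h
    simp [(hball _ h).2 rfl]
  · intro t ht
    rw [Set.uIcc_of_le zero_le_one] at ht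
    have h1 := (hball _ (hmem t ht)).1.hasDerivAt_fst
    have h2 : HasDerivAt (fun t : ℝ => (t : ℂ) * q.1) q.1 t := by
      simpa using (Complex.ofRealCLM.hasDerivAt (x := t)).mul_const q.1
    exact HasDerivAt.comp (h₂ := fun s : ℂ => H (s, q.2)) t h1 h2
  · refine ContinuousOn.intervalIntegrable fun t ht => ?_
    rw [Set.uIcc_of_le zero_le_one] at ht
    have h1 := (hball _ (hmem t ht)).1.derivFst.continuousAt
    have h2 : ContinuousAt (fun t : ℝ => ((t : ℂ) * q.1, q.2)) t := by fun_prop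
    exact ((ContinuousAt.comp (g := _root_.derivFst H)
      (f := fun t : ℝ => ((t : ℂ) * q.1, q.2)) h1 h2).mul
      continuousAt_const).continuousWithinAt

end

theorem shiftPt_shiftPt (d : ℕ) (σ ρ : ℤ × (Fin d → ℤ)) (p : ℂ × (Fin d → ℂ)) :
    shiftPt d σ (shiftPt d ρ p) = shiftPt d (ρ + σ) p := by
  ext <;> simp [shiftPt, sub_sub]

theorem tauMap_shiftPt (d : ℕ) (m : ℤ) (μ : Fin d → ℤ) (p : ℂ × (Fin d → ℂ)) :
    tauMap d (shiftPt d (m, μ) p) = shiftPt d (-m, μ) (tauMap d p) := by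
  ext <;> simp [shiftPt, tauMap]; ring

theorem AnalyticAt.comp_shiftPt {d : ℕ} {F : ℂ × (Fin d → ℂ) → ℂ} {σ : ℤ × (Fin d → ℤ)}
    {p : ℂ × (Fin d → ℂ)} (hF : AnalyticAt ℂ F (shiftPt d σ p)) :
    AnalyticAt ℂ (fun q => F (shiftPt d σ q)) p :=
  AnalyticAt.comp (g := F) (f := shiftPt d σ) hF
    (analyticAt_id.sub (analyticAt_const (v := ((σ.1 : ℂ), fun i => (σ.2 i : ℂ)))))

theorem derivFst_comp_shiftPt {d : ℕ} (F : ℂ × (Fin d → ℂ) → ℂ) (σ : ℤ × (Fin d → ℤ))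
    (p : ℂ × (Fin d → ℂ)) :
    derivFst (fun q => F (shiftPt d σ q)) p = derivFst F (shiftPt d σ p) :=
  deriv_comp_sub_const (f := fun t => F (t, (shiftPt d σ p).2)) (σ.1 : ℂ) p.1

open scoped Pointwise in
theorem support_composeFam_subset {d : ℕ} (a b : Fam d) :
    Function.support (composeFam d a b) ⊆ Function.support a + Function.support b := by
  intro σ hσ
  obtain ⟨p, hp⟩ := Function.ne_iff.1 (Function.mem_support.1 hσ)
  obtain ⟨ρ, hρ⟩ : ∃ ρ, a ρ p * b (σ - ρ) (shiftPt d ρ p) ≠ 0 := by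
    by_contra! h
    exact hp ((finsum_congr h).trans finsum_zero)
  refine Set.mem_add.2 ⟨ρ, fun h => hρ ?_, σ - ρ, fun h => hρ ?_, add_sub_cancel _ _⟩ <;>
    simp [h]

theorem finSuppFam_composeFam {d : ℕ} {a b : Fam d} (ha : FinSuppFam d a)
    (hb : FinSuppFam d b) : FinSuppFam d (composeFam d a b) :=
  (Set.Finite.add ha hb).subset (support_composeFam_subset a b)

theorem finSuppFam_oneFam (d : ℕ) : FinSuppFam d (oneFam d) := by
  refine (Set.finite_singleton 0).subset fun σ hσ => ?_
  by_contra h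
  exact hσ (funext fun p => if_neg h)

theorem finSuppFam_prodFam {d : ℕ} {l : List (Fam d)} (h : ∀ a ∈ l, FinSuppFam d a) :
    FinSuppFam d (prodFam d l) := by
  induction l with
  | nil => exact finSuppFam_oneFam d
  | cons a l ih =>
    exact finSuppFam_composeFam (h a (by simp)) (ih fun b hb => h b (by simp [hb]))

theorem actFam_eq_sum {d : ℕ} {a : Fam d} (ha : (Function.support a).Finite)
    (F : ℂ × (Fin d → ℂ) → ℂ) (p : ℂ × (Fin d → ℂ)) :
    actFam d a F p = ∑ σ ∈ ha.toFinset, a σ p * F (shiftPt d σ p) := by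
  refine finsum_eq_sum_of_support_subset _ fun σ hσ => ha.mem_toFinset.2 fun h => hσ ?_
  simp [h]

open scoped Pointwise in
theorem actFam_composeFam {d : ℕ} {a b : Fam d} (ha : (Function.support a).Finite)
    (hb : (Function.support b).Finite) (F : ℂ × (Fin d → ℂ) → ℂ) (p : ℂ × (Fin d → ℂ)) :
    actFam d (composeFam d a b) F p = actFam d a (actFam d b F) p := by
  classical
  have hsub : Function.support (composeFam d a b) ⊆ ↑(ha.toFinset + hb.toFinset) := by
    rw [Finset.coe_add, Set.Finite.coe_toFinset, Set.Finite.coe_toFinset]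
    exact support_composeFam_subset a b
  have hcomp (σ : ℤ × (Fin d → ℤ)) : composeFam d a b σ p =
      ∑ ρ ∈ ha.toFinset, a ρ p * b (σ - ρ) (shiftPt d ρ p) := by
    refine finsum_eq_sum_of_support_subset _ fun ρ hρ => ha.mem_toFinset.2 fun h => hρ ?_
    simp [h]
  have hact : actFam d (composeFam d a b) F p =
      ∑ σ ∈ ha.toFinset + hb.toFinset, composeFam d a b σ p * F (shiftPt d σ p) := by
    refine finsum_eq_sum_of_support_subset _ fun σ hσ => hsub ?_
    rintro h
    simp [h] at hσ
  rw [hact, actFam_eq_sum ha]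
  simp only [hcomp, Finset.sum_mul]
  rw [Finset.sum_comm]
  refine Finset.sum_congr rfl fun ρ hρ => ?_
  simp only [mul_assoc]
  rw [← Finset.mul_sum]
  congr 1
  rw [actFam, ← finsum_comp_equiv (Equiv.subRight ρ)]
  simp only [Equiv.subRight_apply, shiftPt_shiftPt, add_sub_cancel]
  refine (finsum_eq_sum_of_support_subset _ fun σ hσ => ?_).symm
  rw [Finset.coe_add, Set.Finite.coe_toFinset, Set.Finite.coe_toFinset]
  refine Set.mem_add.2 ⟨ρ, by simpa using hρ, σ - ρ, fun h => hσ ?_, add_sub_cancel _ _⟩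
  simp [h]

theorem actFam_oneFam (d : ℕ) (F : ℂ × (Fin d → ℂ) → ℂ) (p : ℂ × (Fin d → ℂ)) :
    actFam d (oneFam d) F p = F p := by
  rw [actFam, finsum_eq_single _ 0 fun σ hσ => by simp [oneFam, hσ]]
  simp [oneFam, shiftPt]

theorem TauInvFam.actFam_tauMap {d : ℕ} {a : Fam d} (ha : TauInvFam d a) {w₀ : Fin d → ℂ}
    {W : Set (ℂ × (Fin d → ℂ))} (hW : Admissible d w₀ W) {F : ℂ × (Fin d → ℂ) → ℂ}
    (hF : ∀ p ∈ W, F (tauMap d p) = F p) {p : ℂ × (Fin d → ℂ)} (hp : p ∈ W) :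
    actFam d a F (tauMap d p) = actFam d a F p := by
  rw [actFam, actFam, ← finsum_comp_equiv ((Equiv.neg ℤ).prodCongr (Equiv.refl (Fin d → ℤ)))]
  refine finsum_congr fun σ => ?_
  obtain ⟨m, μ⟩ := σ
  simp only [Equiv.prodCongr_apply, Prod.map, Equiv.neg_apply, Equiv.refl_apply]
  rw [← tauMap_shiftPt, hF _ (hW.2.2.2 _ _ hp), ha m μ (tauMap d p)]
  simp [tauMap]

section Even

variable (d : ℕ) (w₀ : Fin d → ℂ) (W : Set (ℂ × (Fin d → ℂ)))

/-- The `τ`-invariant functions analytic on `W`. -/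
abbrev EvenAnalytic :=
  {F : ℂ × (Fin d → ℂ) → ℂ // AnalyticOnNhd ℂ F W ∧ ∀ p ∈ W, F (tauMap d p) = F p}

/-- The span of the functionals `F ↦ F (v - σ)` and `F ↦ ∂₁ F (v - σ)`. -/
def latticeSpan : Submodule ℂ (EvenAnalytic d W → ℂ) :=
  Submodule.span ℂ (Set.range fun σ F => F.1 (shiftPt d σ (0, w₀))) ⊔
    Submodule.span ℂ (Set.range fun σ F => derivFst F.1 (shiftPt d σ (0, w₀)))

variable {d w₀ W}

theorem eval_mem_latticeSpan (σ : ℤ × (Fin d → ℤ)) :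
    (fun F => F.1 (shiftPt d σ (0, w₀))) ∈ latticeSpan d w₀ W :=
  Submodule.mem_sup_left (Submodule.subset_span ⟨σ, rfl⟩)

theorem derivFst_mem_latticeSpan (σ : ℤ × (Fin d → ℤ)) :
    (fun F => derivFst F.1 (shiftPt d σ (0, w₀))) ∈ latticeSpan d w₀ W :=
  Submodule.mem_sup_right (Submodule.subset_span ⟨σ, rfl⟩)

theorem exists_finsum_of_mem_latticeSpan {Λ : EvenAnalytic d W → ℂ}
    (hΛ : Λ ∈ latticeSpan d w₀ W) :
    ∃ c c' : ℤ × (Fin d → ℤ) → ℂ,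
      (Function.support c).Finite ∧ (Function.support c').Finite ∧
      ∀ F : EvenAnalytic d W, Λ F = (∑ᶠ σ, c σ * F.1 (shiftPt d σ (0, w₀))) +
        ∑ᶠ σ, c' σ * derivFst F.1 (shiftPt d σ (0, w₀)) := by
  have hfin (c : ℤ × (Fin d → ℤ) →₀ ℂ) (x : ℤ × (Fin d → ℤ) → ℂ) :
      ∑ᶠ σ, c σ * x σ = c.sum fun σ a => a * x σ := by
    refine finsum_eq_sum_of_support_subset _ fun σ hσ => ?_
    simp only [Finset.mem_coe, Finsupp.mem_support_iff]
    rintro h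
    simp [h] at hσ
  obtain ⟨x, hx, y, hy, rfl⟩ := Submodule.mem_sup.1 hΛ
  obtain ⟨c, rfl⟩ := Finsupp.mem_span_range_iff_exists_finsupp.1 hx
  obtain ⟨c', rfl⟩ := Finsupp.mem_span_range_iff_exists_finsupp.1 hy
  refine ⟨c, c', c.hasFiniteSupport, c'.hasFiniteSupport, fun F => ?_⟩
  rw [hfin, hfin]
  simp [Finsupp.sum, Finset.sum_apply]

/-- A `τ`-invariant function has vanishing first partial derivative on `z₁ = 0`. -/
theorem EvenAnalytic.derivFst_eq_zero (hW : Admissible d w₀ W) (F : EvenAnalytic d W)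
    {p : ℂ × (Fin d → ℂ)} (hp : p ∈ W) (hp0 : p.1 = 0) : derivFst F.1 p = 0 := by
  obtain ⟨z, w⟩ := p
  obtain rfl : z = 0 := hp0
  have h1 : (fun t : ℂ => F.1 (-t, w)) =ᶠ[𝓝 0] fun t => F.1 (t, w) := by
    have hc : ContinuousAt (fun t : ℂ => (t, w)) 0 := by fun_prop
    filter_upwards [hc.eventually (hW.1.mem_nhds hp)] with t ht using F.2.2 _ ht
  have h2 := h1.deriv_eq
  rw [deriv_comp_neg (f := fun t => F.1 (t, w)), neg_zero] at h2
  exact self_eq_neg.1 h2.symm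

/-- The numerator `∑ g_σ · F (· - σ)` of the action of the family `g_σ / z₁`. -/
def shiftSum (s : Finset (ℤ × (Fin d → ℤ))) (g : Fam d) (F : ℂ × (Fin d → ℂ) → ℂ)
    (p : ℂ × (Fin d → ℂ)) : ℂ :=
  ∑ σ ∈ s, g σ p * F (shiftPt d σ p)

variable {s : Finset (ℤ × (Fin d → ℤ))} {g : Fam d}

theorem analyticOnNhd_shiftSum (hW : Admissible d w₀ W)
    (hg : ∀ σ, AnalyticOnNhd ℂ (g σ) W) (F : EvenAnalytic d W) :
    AnalyticOnNhd ℂ (shiftSum s g F.1) W := fun p hp =>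
  Finset.analyticAt_fun_sum _ fun σ _ =>
    (hg σ p hp).mul (F.2.1 _ (hW.2.2.2 σ p hp)).comp_shiftPt

theorem shiftSum_mem_latticeSpan (ρ : ℤ × (Fin d → ℤ)) :
    (fun F => shiftSum s g F.1 (shiftPt d ρ (0, w₀))) ∈ latticeSpan d w₀ W := by
  have : (fun F : EvenAnalytic d W => shiftSum s g F.1 (shiftPt d ρ (0, w₀))) =
      ∑ σ ∈ s, g σ (shiftPt d ρ (0, w₀)) • fun F => F.1 (shiftPt d (ρ + σ) (0, w₀)) := by
    ext F
    simp [shiftSum, Finset.sum_apply, shiftPt_shiftPt]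
  rw [this]
  exact Submodule.sum_mem _ fun σ _ => Submodule.smul_mem _ _ (eval_mem_latticeSpan _)

theorem derivFst_shiftSum (hW : Admissible d w₀ W)
    (hg : ∀ σ, AnalyticOnNhd ℂ (g σ) W) (F : EvenAnalytic d W)
    {p : ℂ × (Fin d → ℂ)} (hp : p ∈ W) :
    derivFst (shiftSum s g F.1) p = ∑ σ ∈ s, (derivFst (g σ) p * F.1 (shiftPt d σ p) +
      g σ p * derivFst F.1 (shiftPt d σ p)) := by
  refine HasDerivAt.deriv ?_
  refine HasDerivAt.fun_sum fun σ _ => ?_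
  rw [← derivFst_comp_shiftPt]
  exact (hg σ p hp).hasDerivAt_fst.mul (F.2.1 _ (hW.2.2.2 σ p hp)).comp_shiftPt.hasDerivAt_fst

theorem derivFst_shiftSum_mem_latticeSpan (hW : Admissible d w₀ W)
    (hg : ∀ σ, AnalyticOnNhd ℂ (g σ) W) (ρ : ℤ × (Fin d → ℤ)) :
    (fun F => derivFst (shiftSum s g F.1) (shiftPt d ρ (0, w₀))) ∈ latticeSpan d w₀ W := by
  have : (fun F : EvenAnalytic d W => derivFst (shiftSum s g F.1) (shiftPt d ρ (0, w₀))) =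
      ∑ σ ∈ s, ((derivFst (g σ) (shiftPt d ρ (0, w₀)) •
          fun F => F.1 (shiftPt d (ρ + σ) (0, w₀))) +
        g σ (shiftPt d ρ (0, w₀)) • fun F => derivFst F.1 (shiftPt d (ρ + σ) (0, w₀))) := by
    ext F
    rw [derivFst_shiftSum hW hg F (hW.2.2.2 ρ _ hW.2.1)]
    simp [Finset.sum_apply, shiftPt_shiftPt]
  rw [this]
  exact Submodule.sum_mem _ fun σ _ => Submodule.add_mem _
    (Submodule.smul_mem _ _ (eval_mem_latticeSpan _))
    (Submodule.smul_mem _ _ (derivFst_mem_latticeSpan _))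

/-- A function on `W` which is odd under `τ` off `z₁ = 0` vanishes on `z₁ = 0`. -/
theorem eq_zero_of_odd (hW : Admissible d w₀ W) {H : ℂ × (Fin d → ℂ) → ℂ}
    (hH : ContinuousOn H W) (hodd : ∀ p ∈ W, p.1 ≠ 0 → H (tauMap d p) = -H p)
    {p : ℂ × (Fin d → ℂ)} (hp : p ∈ W) (hp0 : p.1 = 0) : H p = 0 := by
  obtain ⟨z, w⟩ := p
  obtain rfl : z = 0 := hp0
  have hHp : ContinuousAt H (0, w) := hH.continuousAt (hW.1.mem_nhds hp)
  have hc : ContinuousAt (fun t : ℂ => (t, w)) 0 := by fun_prop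
  have h1 : Tendsto (fun t : ℂ => H (t, w)) (𝓝[≠] 0) (𝓝 (H (0, w))) :=
    (hHp.tendsto.comp hc.tendsto).mono_left nhdsWithin_le_nhds
  have hc' : Tendsto (fun t : ℂ => (-t, w)) (𝓝 0) (𝓝 (0, w)) := by
    have : ContinuousAt (fun t : ℂ => (-t, w)) 0 := by fun_prop
    simpa [ContinuousAt] using this
  have h2 : Tendsto (fun t : ℂ => H (-t, w)) (𝓝[≠] 0) (𝓝 (H (0, w))) :=
    (hHp.tendsto.comp hc').mono_left nhdsWithin_le_nhds
  have h3 : (fun t : ℂ => H (-t, w)) =ᶠ[𝓝[≠] 0] fun t => -H (t, w) := by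
    filter_upwards [nhdsWithin_le_nhds (hc.eventually (hW.1.mem_nhds hp)),
      self_mem_nhdsWithin] with t ht ht0 using hodd _ ht ht0
  exact self_eq_neg.1 (tendsto_nhds_unique h2 (h1.neg.congr' h3.symm))

/-- The action of a `τ`-invariant, at most `1`-singular family on the `τ`-invariant analytic
functions, and its compatibility with `latticeSpan`. -/
theorem exists_operator (hW : Admissible d w₀ W) {a : Fam d}
    (hfin : (Function.support a).Finite) (htau : TauInvFam d a) (hsing : OneSingOn d W a) :
    ∃ T : EvenAnalytic d W → EvenAnalytic d W,
      (∀ Λ ∈ latticeSpan d w₀ W, Λ ∘ T ∈ latticeSpan d w₀ W) ∧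
      ∀ F, ∀ p ∈ W, p.1 ≠ 0 → actFam d a F.1 p = (T F).1 p := by
  choose g hg hag using hsing
  have hact (F : EvenAnalytic d W) {p : ℂ × (Fin d → ℂ)} (hp : p ∈ W) (hp0 : p.1 ≠ 0) :
      actFam d a F.1 p = shiftSum hfin.toFinset g F.1 p / p.1 := by
    rw [actFam_eq_sum hfin, shiftSum, Finset.sum_div]
    refine Finset.sum_congr rfl fun σ _ => ?_
    rw [hag σ p hp hp0]
    ring
  have hodd (F : EvenAnalytic d W) (p : ℂ × (Fin d → ℂ)) (hp : p ∈ W) (hp0 : p.1 ≠ 0) :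
      shiftSum hfin.toFinset g F.1 (tauMap d p) = -shiftSum hfin.toFinset g F.1 p := by
    have h := htau.actFam_tauMap hW F.2.2 hp
    rw [hact F hp hp0, hact F (hW.2.2.1 p hp) (neg_ne_zero.2 hp0)] at h
    simp only [tauMap] at h ⊢
    field_simp at h
    linear_combination -h
  have hzero (F : EvenAnalytic d W) (p : ℂ × (Fin d → ℂ)) (hp : p ∈ W) (hp0 : p.1 = 0) :
      shiftSum hfin.toFinset g F.1 p = 0 :=
    eq_zero_of_odd hW (analyticOnNhd_shiftSum hW hg F).continuousOn (hodd F) hp hp0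
  let T : EvenAnalytic d W → EvenAnalytic d W := fun F =>
    ⟨divFst (shiftSum hfin.toFinset g F.1), fun p hp =>
      (analyticOnNhd_shiftSum hW hg F p hp).divFst <| by
        filter_upwards [hW.1.mem_nhds hp] with q hq using hzero F q hq, fun p hp => by
      by_cases hp0 : p.1 = 0
      · have : tauMap d p = p := by ext <;> simp [tauMap, hp0]
        rw [this]
      · have hp0' : (tauMap d p).1 ≠ 0 := neg_ne_zero.2 hp0
        rw [divFst, divFst, if_neg hp0, if_neg hp0', hodd F p hp hp0]
        simp only [tauMap]
        rw [neg_div_neg_eq]⟩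
  have hT (F : EvenAnalytic d W) (p : ℂ × (Fin d → ℂ)) (hp0 : p.1 ≠ 0) :
      (T F).1 p = shiftSum hfin.toFinset g F.1 p / p.1 := if_neg hp0
  have hT0 (F : EvenAnalytic d W) (p : ℂ × (Fin d → ℂ)) (hp0 : p.1 = 0) :
      (T F).1 p = derivFst (shiftSum hfin.toFinset g F.1) p := if_pos hp0
  refine ⟨T, fun Λ hΛ => ?_, fun F p hp hp0 => by rw [hact F hp hp0, hT F p hp0]⟩
  suffices h : latticeSpan d w₀ W ≤ (latticeSpan d w₀ W).comap (LinearMap.funLeft ℂ ℂ T) from h hΛ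
  refine sup_le (Submodule.span_le.2 ?_) (Submodule.span_le.2 ?_)
  · rintro _ ⟨ρ, rfl⟩
    change (fun F => (T F).1 (shiftPt d ρ (0, w₀))) ∈ latticeSpan d w₀ W
    by_cases h0 : (shiftPt d ρ (0, w₀)).1 = 0
    · simp only [hT0 _ _ h0]
      exact derivFst_shiftSum_mem_latticeSpan hW hg ρ
    · simp only [hT _ _ h0, div_eq_inv_mul]
      exact Submodule.smul_mem _ _ (shiftSum_mem_latticeSpan ρ)
  · rintro _ ⟨ρ, rfl⟩
    change (fun F => derivFst (T F).1 (shiftPt d ρ (0, w₀))) ∈ latticeSpan d w₀ W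
    have hmem := hW.2.2.2 ρ _ hW.2.1
    generalize hq : shiftPt d ρ (0, w₀) = q at hmem
    by_cases h0 : q.1 = 0
    · simp only [EvenAnalytic.derivFst_eq_zero hW _ hmem h0]
      exact Submodule.zero_mem _
    · have hd (F : EvenAnalytic d W) : derivFst (T F).1 q =
          q.1⁻¹ * derivFst (shiftSum hfin.toFinset g F.1) q -
            (q.1 ^ 2)⁻¹ * shiftSum hfin.toFinset g F.1 q := by
        have h1 : (fun t => (T F).1 (t, q.2)) =ᶠ[𝓝 q.1]
            fun t => shiftSum hfin.toFinset g F.1 (t, q.2) / t := by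
          filter_upwards [isOpen_ne.mem_nhds h0] with t ht using hT F (t, q.2) ht
        have h2 := (analyticOnNhd_shiftSum (s := hfin.toFinset) hW hg F q hmem).hasDerivAt_fst.div
          (hasDerivAt_id q.1) h0
        refine (h1.deriv_eq.trans h2.deriv).trans ?_
        simp only [id]
        field_simp
      simp only [hd]
      subst hq
      exact Submodule.sub_mem _
        (Submodule.smul_mem _ _ (derivFst_shiftSum_mem_latticeSpan hW hg ρ))
        (Submodule.smul_mem _ _ (shiftSum_mem_latticeSpan ρ))

theorem exists_operator_prodFam (hW : Admissible d w₀ W) {l : List (Fam d)}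
    (hfin : ∀ a ∈ l, FinSuppFam d a) (htau : ∀ a ∈ l, TauInvFam d a)
    (hsing : ∀ a ∈ l, OneSingOn d W a) :
    ∃ T : EvenAnalytic d W → EvenAnalytic d W,
      (∀ Λ ∈ latticeSpan d w₀ W, Λ ∘ T ∈ latticeSpan d w₀ W) ∧
      ∀ F, ∀ p ∈ W, (∀ n : ℤ, p.1 ≠ n) → actFam d (prodFam d l) F.1 p = (T F).1 p := by
  induction l with
  | nil => exact ⟨id, fun _ h => h, fun F p _ _ => actFam_oneFam d F.1 p⟩
  | cons a l ih =>
    obtain ⟨T, hT, hact⟩ := ih (fun b hb => hfin b (by simp [hb]))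
      (fun b hb => htau b (by simp [hb])) (fun b hb => hsing b (by simp [hb]))
    obtain ⟨U, hU, hactU⟩ := exists_operator hW (hfin a (by simp)) (htau a (by simp))
      (hsing a (by simp))
    refine ⟨U ∘ T, fun Λ hΛ => hT _ (hU _ hΛ), fun F p hp hn => ?_⟩
    rw [prodFam, actFam_composeFam (hfin a (by simp))
      (finSuppFam_prodFam fun b hb => hfin b (by simp [hb])), Function.comp_apply,
      ← hactU _ p hp (by simpa using hn 0)]
    refine finsum_congr fun σ => ?_
    rw [hact F _ (hW.2.2.2 σ p hp) fun n hn' => hn (n + σ.1) ?_]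
    push_cast
    exact sub_eq_iff_eq_add.1 hn'

end Even

/-- **Propositions 3.1 and 3.3 of the paper combined**: the span `S` of the
distributions `D¹, D²` is a module over the universal ring `𝒟_v`.  For a
product `A = a¹ ∘ ⋯ ∘ aᴺ` (`N ≥ 1`) of finitely supported `τ`-invariant, at
most `1`-singular families on an admissible `W`, and any `τ`-invariant `F`
analytic on `W`, the function `A · F` extends analytically at `v = (0, w₀)`;
moreover there are finitely supported coefficients `c, c′` independent of `F`
such that the value of the extension at `v` is
`Σ_σ c_σ · ½ (F (-m, w₀ - μ) + F (m, w₀ - μ)) + Σ_σ c′_σ · ∂₁F (-m, w₀ - μ)`. -/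
theorem module_structure_on_S (d : ℕ) (w₀ : Fin d → ℂ)
    (W : Set (ℂ × (Fin d → ℂ))) (hW : Admissible d w₀ W)
    (l : List (Fam d)) (hl : l ≠ [])
    (hfin : ∀ a ∈ l, FinSuppFam d a)
    (htau : ∀ a ∈ l, TauInvFam d a)
    (hsing : ∀ a ∈ l, OneSingOn d W a) :
    ∃ c c' : ℤ × (Fin d → ℤ) → ℂ,
      (Function.support c).Finite ∧ (Function.support c').Finite ∧
      ∀ F : ℂ × (Fin d → ℂ) → ℂ, AnalyticOnNhd ℂ F W →
        (∀ p ∈ W, F (tauMap d p) = F p) →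
        ∃ G : ℂ × (Fin d → ℂ) → ℂ, AnalyticAt ℂ G ((0 : ℂ), w₀) ∧
          (∀ᶠ p : ℂ × (Fin d → ℂ) in 𝓝 ((0 : ℂ), w₀),
            p.1 ≠ 0 → actFam d (prodFam d l) F p = G p) ∧
          G ((0 : ℂ), w₀) =
            (∑ᶠ σ : ℤ × (Fin d → ℤ), c σ *
              ((1 / 2) * (F (-(σ.1 : ℂ), fun i => w₀ i - (σ.2 i : ℂ)) +
                F ((σ.1 : ℂ), fun i => w₀ i - (σ.2 i : ℂ))))) +
            (∑ᶠ σ : ℤ × (Fin d → ℤ), c' σ *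
              deriv (fun t : ℂ => F (t, fun i => w₀ i - (σ.2 i : ℂ)))
                (-(σ.1 : ℂ))) := by
  obtain ⟨T, hT, hact⟩ := exists_operator_prodFam hW hfin htau hsing
  obtain ⟨c, c', hc, hc', hsum⟩ :=
    exists_finsum_of_mem_latticeSpan (hT _ (eval_mem_latticeSpan (0 : ℤ × (Fin d → ℤ))))
  refine ⟨c, c', hc, hc', fun F hF hFtau => ?_⟩
  have hv (σ : ℤ × (Fin d → ℤ)) :
      shiftPt d σ (0, w₀) = (-(σ.1 : ℂ), fun i => w₀ i - (σ.2 i : ℂ)) := by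
    simp [shiftPt]
  refine ⟨(T ⟨F, hF, hFtau⟩).1, (T ⟨F, hF, hFtau⟩).2.1 _ hW.2.1, ?_, ?_⟩
  · filter_upwards [hW.1.mem_nhds hW.2.1,
      continuousAt_fst.eventually (Metric.ball_mem_nhds (0 : ℂ) one_pos)] with p hp hp1 hp0
    refine hact ⟨F, hF, hFtau⟩ p hp fun n hn => hp0 ?_
    rw [dist_zero_right, hn, Complex.norm_intCast] at hp1
    have hn0 : n = 0 := Int.abs_lt_one_iff.1 (by exact_mod_cast hp1)
    rw [hn, hn0, Int.cast_zero]
  · have h := hsum ⟨F, hF, hFtau⟩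
    simp only [Function.comp_apply] at h
    rw [show shiftPt d 0 (0, w₀) = (0, w₀) by simp [shiftPt]] at h
    rw [h]
    congr 1
    · refine finsum_congr fun σ => ?_
      have h1 := hFtau _ (hW.2.2.2 σ _ hW.2.1)
      rw [hv] at h1 ⊢
      simp only [tauMap, neg_neg] at h1
      rw [h1]
      ring
    · refine finsum_congr fun σ => ?_
      rw [hv, derivFst]

end
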